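/- arXiv:1908.04819 — 3 statements merged into one kernel-verified Lean document; each statement's English description precedes it below -/
import Mathlib

section
/- Let $A$ be an $F$-finite Noetherian ring of prime characteristic $p > 0$ and let $\mathfrak{p} \subseteq \mathfrak{q}$ be prime ideals of $A$. Then for every $e > 0$, $[\kappa(\mathfrak{p})^{1/p^e} : \kappa(\mathfrak{p})] = [\kappa(\mathfrak{q})^{1/p^e} : \kappa(\mathfrak{q})] \cdot p^{e \dim(A_{\mathfrak{q}}/\mathfrak{p} A_{\mathfrak{q}})}$. -/
open Module IsLocalRing

section Frob

/-- `F^e_* M`: the abelian group `M` with `R`-module structure restricted along the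
`e`-th iterated Frobenius of `R`. -/
def FrobMod (p e : ℕ) (R M : Type*) : Type _ := M

instance FrobMod.addCommGroup {p e : ℕ} {R M : Type*} [AddCommGroup M] :
    AddCommGroup (FrobMod p e R M) :=
  inferInstanceAs (AddCommGroup M)

noncomputable instance FrobMod.module {p e : ℕ} {R M : Type*} [CommRing R] [ExpChar R p]
    [AddCommGroup M] [Module R M] : Module R (FrobMod p e R M) :=
  Module.compHom M (iterateFrobenius R p e)

/-- `F^e_* B` (a.k.a. `B^{1/p^e}`) as a ring. -/
def FrobAlg (p e : ℕ) (B : Type*) : Type _ := B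

instance FrobAlg.commRing {p e : ℕ} {B : Type*} [CommRing B] : CommRing (FrobAlg p e B) :=
  inferInstanceAs (CommRing B)

/-- If `B` is an `A`-algebra, then `F^e_* B` is an `A`-algebra via `A → B` composed with
the `e`-th iterated Frobenius of `B`. -/
noncomputable instance FrobAlg.algebra {p e : ℕ} {A B : Type*} [CommRing A] [CommRing B]
    [Algebra A B] [ExpChar B p] : Algebra A (FrobAlg p e B) :=
  ((iterateFrobenius B p e).comp (algebraMap A B)).toAlgebra

/-- The `p`-degree `[k^{1/p^e} : k]` of a ring `k` of characteristic `p`. -/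
noncomputable def pDeg (p e : ℕ) (k : Type*) [CommRing k] [ExpChar k p] : ℕ :=
  Module.finrank k (FrobAlg p e k)

/-- The length of an `R`-module `M`, as the Krull dimension of its submodule lattice. -/
noncomputable def modLength (R M : Type*) [CommRing R] [AddCommGroup M] [Module R M] :
    WithBot ℕ∞ :=
  Order.krullDim (Submodule R M)

/-- The minimal number of generators of an `R`-module `M`. -/
noncomputable def minGens (R M : Type*) [CommRing R] [AddCommGroup M] [Module R M] : ℕ :=
  sInf {n : ℕ | ∃ s : Finset M, s.card = n ∧ Submodule.span R (s : Set M) = ⊤}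

/-- The bracket power `I^{[p^e]}`. -/
noncomputable def bracketPow {R : Type*} [CommRing R] (p e : ℕ) [ExpChar R p] (I : Ideal R) :
    Ideal R :=
  I.map (iterateFrobenius R p e)

end Frob

namespace Module

variable {R M N : Type*} [CommRing R] [AddCommGroup M] [Module R M] [AddCommGroup N] [Module R N]

lemma length_quotient_map_of_injective {f : N →ₗ[R] M} (hf : Function.Injective f)
    (S : Submodule R N) :
    Module.length R (M ⧸ S.map f) =
      Module.length R (N ⧸ S) + Module.length R (M ⧸ LinearMap.range f) := by
  refine Module.length_eq_add_of_exact (S.mapQ (S.map f) f (Submodule.le_comap_map f S))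
    (Submodule.factor LinearMap.map_le_range) ?_ (Submodule.factor_surjective _) ?_
  · rw [← LinearMap.ker_eq_bot, Submodule.ker_mapQ, Submodule.comap_map_eq_of_injective hf,
      Submodule.mkQ_map_self]
  · rw [LinearMap.exact_iff, Submodule.range_mapQ, Submodule.factor, Submodule.ker_mapQ,
      Submodule.comap_id]

lemma length_pi_quotient_smul (ι : Type*) [Fintype ι] (x : R) :
    Module.length R ((ι → R) ⧸ LinearMap.range (LinearMap.lsmul R (ι → R) x)) =
      Fintype.card ι * Ring.ord R x := by
  let g : (ι → R) →ₗ[R] (ι → R ⧸ Ideal.span {x}) :=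
    LinearMap.compLeft (Submodule.mkQ (Ideal.span {x})) ι
  have hg : Function.Surjective g := fun y ↦ by
    choose z hz using fun i ↦ Submodule.mkQ_surjective (Ideal.span {x}) (y i)
    exact ⟨z, funext hz⟩
  have hker : LinearMap.range (LinearMap.lsmul R (ι → R) x) = LinearMap.ker g := by
    ext y
    simp only [LinearMap.mem_range, LinearMap.mem_ker, funext_iff, g, LinearMap.compLeft_apply,
      Function.comp_apply, Pi.zero_apply, Submodule.mkQ_apply, Submodule.Quotient.mk_eq_zero,
      Ideal.mem_span_singleton, LinearMap.lsmul_apply, Pi.smul_apply, smul_eq_mul]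
    constructor
    · rintro ⟨z, hz⟩ i
      exact ⟨z i, (hz i).symm⟩
    · intro h
      choose z hz using h
      exact ⟨z, fun i ↦ (hz i).symm⟩
  rw [hker, (g.quotKerEquivOfSurjective hg).length_eq, Module.length_pi_of_fintype]
  simp [Ring.ord]

lemma isFiniteLength_of_isTorsion [IsNoetherianRing R] [Ring.KrullDimLE 1 R] [Module.Finite R M]
    (hM : Module.IsTorsion R M) : IsFiniteLength R M := by
  obtain ⟨a, ha, ha0⟩ := Submodule.annihilator_top_inter_nonZeroDivisors hM
  obtain ⟨n, f, hf⟩ := Module.Finite.exists_fin' R M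
  have h1 : Module.length R (M ⧸ LinearMap.range (LinearMap.lsmul R M a)) ≠ ⊤ := by
    let φ : ((Fin n → R) ⧸ LinearMap.range (LinearMap.lsmul R (Fin n → R) a)) →ₗ[R]
        (M ⧸ LinearMap.range (LinearMap.lsmul R M a)) := Submodule.mapQ _ _ f <| by
      rintro _ ⟨y, rfl⟩
      exact ⟨f y, by simp⟩
    have hφ : Function.Surjective φ := by
      intro y
      obtain ⟨y, rfl⟩ := Submodule.mkQ_surjective _ y
      obtain ⟨z, rfl⟩ := hf y
      exact ⟨Submodule.mkQ _ z, by simp [φ]⟩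
    refine ne_top_of_le_ne_top ?_ (Module.length_le_of_surjective φ hφ)
    rw [length_pi_quotient_smul]
    obtain ⟨m, hm⟩ := ENat.ne_top_iff_exists.1 (Ring.ord_ne_top ha0)
    rw [← hm, ← Nat.cast_mul]
    exact ENat.natCast_ne_top _
  have h2 : LinearMap.range (LinearMap.lsmul R M a) = ⊥ := by
    rw [eq_bot_iff]
    rintro _ ⟨y, rfl⟩
    simpa using Submodule.mem_annihilator.1 ha y trivial
  rw [← Module.length_ne_top_iff]
  rwa [(Submodule.quotEquivOfEqBot _ h2).length_eq] at h1

/-- Over a one-dimensional Noetherian domain, a finite torsion-free module `M` satisfies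
`ℓ(M / x M) = rank M * ℓ(R / x R)` for `x ≠ 0`. -/
lemma length_quotient_smul_eq_finrank_mul_ord [IsDomain R] [IsNoetherianRing R]
    [Ring.KrullDimLE 1 R] [Module.Finite R M] [Module.IsTorsionFree R M] {x : R} (hx : x ≠ 0) :
    Module.length R (M ⧸ LinearMap.range (LinearMap.lsmul R M x)) =
      Module.finrank R M * Ring.ord R x := by
  obtain ⟨s, hs, hli⟩ :=
    exists_finset_linearIndependent_of_le_finrank (le_refl (Module.finrank R M))
  let f : (s → R) →ₗ[R] M := Fintype.linearCombination R (Subtype.val : s → M)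
  have hf : Function.Injective f := linearIndependent_iff_injective_fintypeLinearCombination.1 hli
  have hT : Module.IsTorsion R (M ⧸ LinearMap.range f) := by
    rw [← Module.finrank_eq_zero_iff_isTorsion]
    have h1 := Submodule.finrank_quotient_add_finrank (LinearMap.range f)
    rw [LinearMap.finrank_range_of_inj hf] at h1
    rw [Module.finrank_pi, Fintype.card_coe, hs] at h1
    omega
  have hfin := Module.length_ne_top_iff.2 (isFiniteLength_of_isTorsion hT)
  have hxM : Function.Injective (LinearMap.lsmul R M x) := fun a b h ↦
    smul_right_injective M hx h
  have e1 := length_quotient_map_of_injective hxM (LinearMap.range f)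
  have e2 := length_quotient_map_of_injective hf (LinearMap.range (LinearMap.lsmul R (s → R) x))
  have e3 : (LinearMap.range f).map (LinearMap.lsmul R M x) =
      (LinearMap.range (LinearMap.lsmul R (s → R) x)).map f := by
    rw [← LinearMap.range_comp, ← LinearMap.range_comp]
    congr 1
    ext
    simp
  rw [e3, e2, length_pi_quotient_smul, add_comm, Fintype.card_coe, hs] at e1
  exact (ENat.add_right_injective_of_ne_top hfin e1).symm

end Module

namespace FrobAlg

variable {p e : ℕ}

instance nontrivial {B : Type*} [Nontrivial B] : Nontrivial (FrobAlg p e B) :=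
  inferInstanceAs (Nontrivial B)

instance isDomain {B : Type*} [CommRing B] [IsDomain B] : IsDomain (FrobAlg p e B) :=
  inferInstanceAs (IsDomain B)

instance isLocalRing {B : Type*} [CommRing B] [IsLocalRing B] : IsLocalRing (FrobAlg p e B) :=
  inferInstanceAs (IsLocalRing B)

/-- The ring homomorphism `F^e_* A → F^e_* B` underlying the algebra map `A → B`. -/
noncomputable instance algebraFrobAlg {A B : Type*} [CommRing A] [CommRing B] [Algebra A B] :
    Algebra (FrobAlg p e A) (FrobAlg p e B) :=
  inferInstanceAs (Algebra A B)

/-- The identity map `B → F^e_* B`, as a ring isomorphism. -/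
def of (p e : ℕ) (B : Type*) [CommRing B] : B ≃+* FrobAlg p e B :=
  RingEquiv.refl B

lemma algebraMap_apply {A B : Type*} [CommRing A] [CommRing B] [Algebra A B] [ExpChar B p]
    (a : A) : algebraMap A (FrobAlg p e B) a = of p e B (algebraMap A B a ^ p ^ e) :=
  rfl

lemma algebraMap_of {A B : Type*} [CommRing A] [CommRing B] [Algebra A B] (a : A) :
    algebraMap (FrobAlg p e A) (FrobAlg p e B) (of p e A a) = of p e B (algebraMap A B a) :=
  rfl

instance isScalarTower {A B : Type*} [CommRing A] [CommRing B] [Algebra A B] [ExpChar B p] :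
    IsScalarTower A B (FrobAlg p e B) :=
  .of_algebraMap_eq fun _ ↦ rfl

instance isScalarTower_frobAlg {A B : Type*} [CommRing A] [CommRing B] [Algebra A B] [ExpChar A p]
    [ExpChar B p] : IsScalarTower A (FrobAlg p e A) (FrobAlg p e B) :=
  .of_algebraMap_eq fun a ↦ by
    rw [algebraMap_apply, algebraMap_apply, algebraMap_of, map_pow, map_pow, map_pow, Algebra.algebraMap_self,
      RingHom.id_apply]

instance isFractionRing {A K : Type*} [CommRing A] [CommRing K] [Algebra A K]
    [IsFractionRing A K] : IsFractionRing (FrobAlg p e A) (FrobAlg p e K) :=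
  inferInstanceAs (IsFractionRing A K)

instance isLocalHom {B : Type*} [CommRing B] [ExpChar B p] :
    IsLocalHom (algebraMap B (FrobAlg p e B)) where
  map_nonunit a ha := by
    have h : IsUnit (a ^ p ^ e) := ha
    exact (isUnit_pow_iff (pow_ne_zero _ (expChar_pos B p).ne')).1 h

instance faithfulSMul {B : Type*} [CommRing B] [IsDomain B] [ExpChar B p] :
    FaithfulSMul B (FrobAlg p e B) :=
  (faithfulSMul_iff_algebraMap_injective _ _).2 (iterateFrobenius_inj B p e)

lemma finite_iff {B : Type*} [CommRing B] [ExpChar B p] :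
    Module.Finite B (FrobAlg p e B) ↔ (iterateFrobenius B p e).Finite :=
  Iff.rfl

lemma finite_of_finite_one {B : Type*} [CommRing B] [ExpChar B p]
    [h : Module.Finite B (FrobAlg p 1 B)] : Module.Finite B (FrobAlg p e B) := by
  rw [finite_iff] at h ⊢
  induction e with
  | zero => rw [iterateFrobenius_zero]; exact RingHom.Finite.id B
  | succ n ih => rw [iterateFrobenius_add]; exact ih.comp h

lemma finite_quotient {B : Type*} [CommRing B] [ExpChar B p] [h : Module.Finite B (FrobAlg p e B)]
    (I : Ideal B) [ExpChar (B ⧸ I) p] : Module.Finite (B ⧸ I) (FrobAlg p e (B ⧸ I)) := by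
  rw [finite_iff] at h ⊢
  have h2 : ((iterateFrobenius (B ⧸ I) p e).comp (Ideal.Quotient.mk I)).Finite := by
    rw [← RingHom.iterateFrobenius_comm]
    exact (RingHom.Finite.of_surjective _ Ideal.Quotient.mk_surjective).comp h
  exact .of_comp_finite h2

lemma finite_of_isLocalization {A B : Type*} [CommRing A] [CommRing B] [Algebra A B]
    (S : Submonoid A) [IsLocalization S B] [ExpChar A p] [ExpChar B p]
    [Module.Finite A (FrobAlg p e A)] : Module.Finite B (FrobAlg p e B) := by
  let S' : Submonoid (FrobAlg p e A) := S.map (of p e A : A →* FrobAlg p e A)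
  have h1 : IsLocalization S' (FrobAlg p e B) := by
    have : S' = S := Submonoid.ext fun x ↦ ⟨by rintro ⟨y, hy, rfl⟩; exact hy, fun h ↦ ⟨x, h, rfl⟩⟩
    rw [this]
    exact inferInstanceAs (IsLocalization S B)
  have h2 : IsLocalization (Algebra.algebraMapSubmonoid (FrobAlg p e A) S) (FrobAlg p e B) := by
    refine (IsLocalization.iff_of_le_of_exists_dvd _ S' ?_ ?_).2 h1
    · rintro _ ⟨s, hs, rfl⟩
      exact ⟨s ^ p ^ e, pow_mem hs _, rfl⟩
    · rintro _ ⟨s, hs, rfl⟩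
      exact ⟨_, ⟨s, hs, rfl⟩, dvd_pow_self (of p e A s) (pow_ne_zero _ (expChar_pos A p).ne')⟩
  exact Module.Finite.of_isLocalization A (FrobAlg p e A) S

end FrobAlg

lemma RingEquiv.pDeg_eq {p e : ℕ} {K L : Type*} [CommRing K] [CommRing L] [ExpChar K p]
    [ExpChar L p] (f : K ≃+* L) : pDeg p e K = pDeg p e L := by
  let g : FrobAlg p e K ≃+* FrobAlg p e L := f
  refine Algebra.finrank_eq_of_equiv_equiv f g (RingHom.ext fun x ↦ ?_)
  exact (map_pow f x (p ^ e)).symm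

/-- The one-dimensional local case of Kunz's formula. -/
theorem pDeg_fractionField_eq_of_isLocalRing {p e : ℕ} (B K : Type*) [CommRing B] [IsDomain B]
    [IsLocalRing B] [IsNoetherianRing B] [Ring.KrullDimLE 1 B] [ExpChar B p] [CommRing K]
    [Algebra B K] [IsFractionRing B K] [ExpChar K p] [ExpChar (ResidueField B) p]
    [Module.Finite B (FrobAlg p e B)] (hB : ¬ IsField B) :
    pDeg p e K = pDeg p e (ResidueField B) * p ^ e := by
  obtain ⟨x, hx, hx0⟩ := Submodule.exists_mem_ne_zero_of_ne_bot
    (IsLocalRing.isField_iff_maximalIdeal_eq.not.1 hB)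
  have hxn : x ∈ nonZeroDivisors B := mem_nonZeroDivisors_of_ne_zero hx0
  obtain ⟨m, hm⟩ := ENat.ne_top_iff_exists.1 (Ring.ord_ne_top hxn)
  have hm0 : m ≠ 0 := by
    rintro rfl
    rw [Ring.ord, eq_comm, Nat.cast_zero, Module.length_eq_zero_iff,
      Submodule.Quotient.subsingleton_iff, Ideal.span_singleton_eq_top] at hm
    exact hx hm
  let N := FrobAlg p e B ⧸ Ideal.span {algebraMap B (FrobAlg p e B) x}
  have h1 : Module.length B N = Module.finrank B (FrobAlg p e B) * Ring.ord B x := by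
    rw [← Module.length_quotient_smul_eq_finrank_mul_ord hx0]
    let I : Submodule (FrobAlg p e B) (FrobAlg p e B) :=
      Ideal.span {algebraMap B (FrobAlg p e B) x}
    have hI : LinearMap.range (LinearMap.lsmul B (FrobAlg p e B) x) = I.restrictScalars B := by
      ext y
      simp only [LinearMap.mem_range, LinearMap.lsmul_apply, Submodule.restrictScalars_mem, I,
        Ideal.mem_span_singleton, Algebra.smul_def]
      exact exists_congr fun z ↦ eq_comm
    rw [hI]
    exact (Submodule.Quotient.restrictScalarsEquiv B I).symm.length_eq
  have h2 : Module.length (FrobAlg p e B) N = (p ^ e * m : ℕ) := by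
    have : Module.length (FrobAlg p e B) N = Ring.ord B (x ^ p ^ e) := rfl
    rw [this, Ring.ord_pow hxn, ← hm]
    simp
  have h3 := IsLocalRing.length_restrictScalars B (FrobAlg p e B) N
  have hfin : Module.Finite (ResidueField B) (ResidueField (FrobAlg p e B)) := inferInstance
  have h4 : Module.finrank (ResidueField B) (ResidueField (FrobAlg p e B)) =
      pDeg p e (ResidueField B) := by
    let g : ResidueField (FrobAlg p e B) ≃+* FrobAlg p e (ResidueField B) :=
      RingEquiv.refl (ResidueField B)
    refine Algebra.finrank_eq_of_equiv_equiv (RingEquiv.refl _) g (RingHom.ext fun y ↦ ?_)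
    obtain ⟨y, rfl⟩ := IsLocalRing.residue_surjective y
    exact (map_pow (residue B) y (p ^ e)).symm
  rw [h1, h2, Module.length_eq_finrank, h4, ← hm] at h3
  norm_cast at h3
  have h5 : pDeg p e K = Module.finrank B (FrobAlg p e B) :=
    IsFractionRing.finrank_eq B K (FrobAlg p e B) (FrobAlg p e K)
  rw [h5]
  apply Nat.eq_of_mul_eq_mul_right (Nat.pos_of_ne_zero hm0)
  rw [h3]
  ring

lemma charP_of_ringHom_of_prime {A B : Type*} [CommRing A] [CommRing B] [Nontrivial B] (p : ℕ)
    [hp : Fact p.Prime] [CharP A p] (f : A →+* B) : CharP B p := by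
  rw [CharP.charP_iff_prime_eq_zero hp.out, ← map_natCast f, CharP.cast_eq_zero, map_zero]

/-- Kunz's formula for a minimal nonzero prime of a domain. -/
theorem pDeg_fractionField_eq_of_minimal {p : ℕ} [Fact p.Prime] {e : ℕ} (A K : Type*) [CommRing A]
    [IsDomain A] [IsNoetherianRing A] [CharP A p] [Module.Finite A (FrobAlg p e A)] [CommRing K]
    [Algebra A K] [IsFractionRing A K] [ExpChar K p] (q : Ideal A) [q.IsPrime]
    [ExpChar q.ResidueField p] (hq : q ≠ ⊥)
    (hmin : ∀ J : Ideal A, J.IsPrime → J ≠ ⊥ → J ≤ q → J = q) :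
    pDeg p e K = pDeg p e q.ResidueField * p ^ e := by
  let B := Localization.AtPrime q
  have : IsDomain B := IsLocalization.isDomain_localization q.primeCompl_le_nonZeroDivisors
  have : CharP B p := charP_of_ringHom_of_prime p (algebraMap A B)
  have : Module.Finite B (FrobAlg p e B) := FrobAlg.finite_of_isLocalization q.primeCompl
  have : Ring.KrullDimLE 1 B := by
    refine Ring.krullDimLE_one_iff_of_noZeroDivisors.2 fun J hJ hJp ↦ ?_
    have hle : J.comap (algebraMap A B) ≤ q :=
      (Ideal.comap_mono (le_maximalIdeal hJp.ne_top)).trans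
        (IsLocalization.AtPrime.under_maximalIdeal B q).le
    have hJ' : J = (J.comap (algebraMap A B)).map (algebraMap A B) :=
      (IsLocalization.map_under q.primeCompl B J).symm
    have h0 : J.comap (algebraMap A B) ≠ ⊥ := by
      intro h0
      rw [hJ', h0, Ideal.map_bot] at hJ
      exact hJ rfl
    rw [hJ', hmin _ inferInstance h0 hle, IsLocalization.AtPrime.map_eq_maximalIdeal q B]
    infer_instance
  have hfield : ¬ IsField B := by
    rwa [IsLocalRing.isField_iff_maximalIdeal_eq, ← IsLocalization.AtPrime.map_eq_maximalIdeal q B,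
      Ideal.map_eq_bot_iff_of_injective
        (IsLocalization.injective B q.primeCompl_le_nonZeroDivisors)]
  let := IsLocalization.localizationAlgebraOfSubmonoidLe B K q.primeCompl (nonZeroDivisors A)
    q.primeCompl_le_nonZeroDivisors
  have := IsLocalization.localization_isScalarTower_of_submonoid_le B K q.primeCompl
    (nonZeroDivisors A) q.primeCompl_le_nonZeroDivisors
  have : IsFractionRing B K :=
    IsFractionRing.isFractionRing_of_isDomain_of_isLocalization q.primeCompl B K
  exact pDeg_fractionField_eq_of_isLocalRing B K hfield

/-- Kunz's formula for a pair of primes with no prime strictly in between. -/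
theorem pDeg_residueField_eq_of_covBy {p : ℕ} [Fact p.Prime] {e : ℕ} {A : Type*} [CommRing A]
    [IsNoetherianRing A] [CharP A p] [Module.Finite A (FrobAlg p e A)] {P Q : PrimeSpectrum A}
    (h : P ⋖ Q) [ExpChar P.asIdeal.ResidueField p] [ExpChar Q.asIdeal.ResidueField p] :
    pDeg p e P.asIdeal.ResidueField = pDeg p e Q.asIdeal.ResidueField * p ^ e := by
  let π : A →+* A ⧸ P.asIdeal := Ideal.Quotient.mk P.asIdeal
  have hπ : Function.Surjective π := Ideal.Quotient.mk_surjective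
  have hker : RingHom.ker π ≤ Q.asIdeal := by
    rw [Ideal.mk_ker]
    exact h.le
  let q : Ideal (A ⧸ P.asIdeal) := Q.asIdeal.map π
  have hq : q.IsPrime := Ideal.map_isPrime_of_surjective hπ hker
  have hqQ : Q.asIdeal = q.comap π := by
    rw [Ideal.comap_map_of_surjective' π hπ, sup_eq_left.2 hker]
  have : CharP (A ⧸ P.asIdeal) p := charP_of_ringHom_of_prime p π
  have : CharP q.ResidueField p := charP_of_ringHom_of_prime p (algebraMap (A ⧸ P.asIdeal) _)
  have : Module.Finite (A ⧸ P.asIdeal) (FrobAlg p e (A ⧸ P.asIdeal)) :=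
    FrobAlg.finite_quotient P.asIdeal
  have e1 : pDeg p e Q.asIdeal.ResidueField = pDeg p e q.ResidueField :=
    (RingEquiv.ofBijective _ ((RingHom.surjectiveOnStalks_of_surjective
      hπ).residueFieldMap_bijective Q.asIdeal q hqQ)).pDeg_eq
  rw [e1]
  refine pDeg_fractionField_eq_of_minimal (A ⧸ P.asIdeal) _ q ?_ fun J hJ hJ0 hJq ↦ ?_
  · intro h0
    refine h.lt.not_ge ?_
    change Q.asIdeal ≤ P.asIdeal
    rw [hqQ, h0, ← RingHom.ker_eq_comap_bot, Ideal.mk_ker]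
  · let J' : PrimeSpectrum A := ⟨J.comap π, inferInstance⟩
    have hJ' : J'.asIdeal.map π = J := Ideal.map_comap_of_surjective π hπ J
    have hPJ : P ≤ J' := by
      change P.asIdeal ≤ J.comap π
      exact (Ideal.mk_ker (I := P.asIdeal)).ge.trans (Ideal.comap_mono bot_le)
    have hJQ : J' ≤ Q := by
      change J.comap π ≤ Q.asIdeal
      rw [hqQ]
      exact Ideal.comap_mono hJq
    rcases h.eq_or_eq hPJ hJQ with h' | h'
    · refine absurd ?_ hJ0
      rw [← hJ', h', Ideal.map_quotient_self]
    · rw [← hJ', h']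

/-- Kunz's formula for the generic point of a domain. -/
theorem pDeg_residueField_bot_eq {p : ℕ} [Fact p.Prime] {e : ℕ} {A : Type*} [CommRing A]
    [IsDomain A] [IsNoetherianRing A] [CharP A p] [Module.Finite A (FrobAlg p e A)] (n : ℕ)
    (Q : PrimeSpectrum A) (hQ : Order.height Q = n) [ExpChar (⊥ : Ideal A).ResidueField p]
    [ExpChar Q.asIdeal.ResidueField p] :
    pDeg p e (⊥ : Ideal A).ResidueField = pDeg p e Q.asIdeal.ResidueField * p ^ (e * n) := by
  induction n generalizing Q with
  | zero =>
    have : Q = ⊥ := by simpa using hQ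
    subst this
    simp only [mul_zero, pow_zero, mul_one]
    rfl
  | succ n ih =>
    obtain ⟨s, hs, hlen⟩ := Order.exists_series_of_height_eq_coe Q hQ
    have hs' : (s.length : ℕ∞) = Order.height s.last := by rw [hs, hlen, hQ]
    let i : Fin (s.length + 1) := ⟨n, by omega⟩
    have hi : Order.height (s i) = n := Order.height_eq_index_of_length_eq_height_last hs' i
    have hcov : s i ⋖ Q := by
      refine ⟨?_, fun R hR hRQ ↦ ?_⟩
      · rw [← hs]
        exact s.strictMono (Fin.mk_lt_mk.2 (by omega))
      · have h1 := Order.height_add_one_le hR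
        have h2 := Order.height_add_one_le hRQ
        rw [hi] at h1
        rw [hQ] at h2
        have h3 := (add_le_add_left h1 1).trans h2
        norm_cast at h3
        omega
    have : CharP (s i).asIdeal.ResidueField p :=
      charP_of_ringHom_of_prime p (algebraMap A (s i).asIdeal.ResidueField)
    rw [ih (s i) hi, pDeg_residueField_eq_of_covBy hcov]
    ring

/-- Kunz's formula: for an `F`-finite Noetherian ring `A` of prime characteristic `p` and
primes `𝔭 ⊆ 𝔮`, one has
`[κ(𝔭)^{1/p^e} : κ(𝔭)] = [κ(𝔮)^{1/p^e} : κ(𝔮)] ⬝ p^{e · dim(A_𝔮 / 𝔭 A_𝔮)}`,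
where `κ(𝔭) = Frac(A ⧸ 𝔭)` and `A_𝔮/𝔭A_𝔮 ≅ (A ⧸ 𝔭)` localized at `𝔮/𝔭`. -/
theorem stmt8 (p : ℕ) [Fact p.Prime] (A : Type*) [CommRing A] [IsNoetherianRing A]
    [CharP A p] [Module.Finite A (FrobAlg p 1 A)]
    (P Q : PrimeSpectrum A) (hPQ : P.asIdeal ≤ Q.asIdeal)
    [CharP (FractionRing (A ⧸ P.asIdeal)) p]
    [CharP (FractionRing (A ⧸ Q.asIdeal)) p]
    [hq' : (Q.asIdeal.map (Ideal.Quotient.mk P.asIdeal)).IsPrime]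
    (n : ℕ)
    (hn : ringKrullDim
        (Localization.AtPrime (Q.asIdeal.map (Ideal.Quotient.mk P.asIdeal))) = n)
    (e : ℕ) (he : 0 < e) :
    pDeg p e (FractionRing (A ⧸ P.asIdeal)) =
      pDeg p e (FractionRing (A ⧸ Q.asIdeal)) * p ^ (e * n) := by
  have : Module.Finite A (FrobAlg p e A) := FrobAlg.finite_of_finite_one
  have : CharP (A ⧸ P.asIdeal) p :=
    charP_of_ringHom_of_prime p (Ideal.Quotient.mk P.asIdeal)
  have : Module.Finite (A ⧸ P.asIdeal) (FrobAlg p e (A ⧸ P.asIdeal)) :=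
    FrobAlg.finite_quotient P.asIdeal
  let q : PrimeSpectrum (A ⧸ P.asIdeal) := ⟨_, hq'⟩
  have hq : Order.height q = n := by
    rw [IsLocalization.AtPrime.ringKrullDim_eq_height q.asIdeal,
      PrimeSpectrum.height_eq_orderHeight] at hn
    exact_mod_cast hn
  have hqQ : Q.asIdeal = q.asIdeal.comap (Ideal.Quotient.mk P.asIdeal) := by
    rw [Ideal.comap_map_of_surjective' _ Ideal.Quotient.mk_surjective, Ideal.mk_ker,
      sup_eq_left.2 hPQ]
  have : CharP (⊥ : Ideal (A ⧸ P.asIdeal)).ResidueField p :=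
    charP_of_ringHom_of_prime p (algebraMap (A ⧸ P.asIdeal) _)
  have : CharP q.asIdeal.ResidueField p :=
    charP_of_ringHom_of_prime p (algebraMap (A ⧸ P.asIdeal) _)
  have e1 : pDeg p e (FractionRing (A ⧸ P.asIdeal)) =
      pDeg p e (⊥ : Ideal (A ⧸ P.asIdeal)).ResidueField :=
    (FractionRing.algEquiv (A ⧸ P.asIdeal) _).toRingEquiv.pDeg_eq
  have e2 : pDeg p e (FractionRing (A ⧸ Q.asIdeal)) = pDeg p e q.asIdeal.ResidueField :=
    ((FractionRing.algEquiv (A ⧸ Q.asIdeal) Q.asIdeal.ResidueField).toRingEquiv.trans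
      (RingEquiv.ofBijective _ ((RingHom.surjectiveOnStalks_of_surjective
        Ideal.Quotient.mk_surjective).residueFieldMap_bijective Q.asIdeal q.asIdeal hqQ))).pDeg_eq
  rw [e1, e2]
  exact pDeg_residueField_bot_eq n q hq
end

section
/- Let $\varphi: A \to R$ be a finite type map of Noetherian rings with $A$ a domain with fraction field $K$, and let $M$ be a finitely generated $R$-module. If $c \in R$ is a nonzerodivisor on $M$, then the set of primes $\mathfrak{p} \in \Spec(A)$ such that the image of $c$ is a nonzerodivisor on $M \otimes_A \kappa(\mathfrak{p})$ contains a nonempty open subset of $\Spec(A)$. -/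
/-- The residue field `κ(𝔭) = Frac(A ⧸ 𝔭)` as an `A`-algebra. -/
noncomputable instance residueFieldAlgebra {A : Type*} [CommRing A] (I : Ideal A)
    [I.IsPrime] : Algebra A (FractionRing (A ⧸ I)) :=
  ((algebraMap (A ⧸ I) (FractionRing (A ⧸ I))).comp (Ideal.Quotient.mk I)).toAlgebra

open scoped TensorProduct

theorem Module.Flat.of_exact {A N₁ N₂ N₃ : Type*} [CommRing A]
    [AddCommGroup N₁] [Module A N₁] [AddCommGroup N₂] [Module A N₂]
    [AddCommGroup N₃] [Module A N₃] (f : N₁ →ₗ[A] N₂) (g : N₂ →ₗ[A] N₃)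
    (hfg : Function.Exact f g) (hg : Function.Surjective g)
    [Module.Flat A N₁] [Module.Flat A N₃] (hf : Function.Injective f) :
    Module.Flat A N₂ := by
  rw [Module.Flat.iff_rTensor_injective']
  intro I
  rw [injective_iff_map_eq_zero]
  intro x hx
  have h₃ : g.lTensor I x = 0 := by
    apply Module.Flat.rTensor_preserves_injective_linearMap (M := N₃) I.subtype
      I.injective_subtype
    rw [map_zero, ← LinearMap.comp_apply, LinearMap.rTensor_comp_lTensor,
      ← LinearMap.lTensor_comp_rTensor, LinearMap.comp_apply, hx, map_zero]
  obtain ⟨y, rfl⟩ := (_root_.lTensor_exact I hfg hg x).1 h₃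
  have hy : I.subtype.rTensor N₁ y = 0 := by
    apply LinearMap.lTensor_injective_of_exact_of_flat g hg f hf hfg A
    rw [map_zero, ← hx, ← LinearMap.comp_apply, ← LinearMap.comp_apply,
      LinearMap.rTensor_comp_lTensor, LinearMap.lTensor_comp_rTensor]
  rw [(injective_iff_map_eq_zero _).1 (Module.Flat.rTensor_preserves_injective_linearMap
    (M := N₁) I.subtype I.injective_subtype) y hy, map_zero]

/-- If `Q` is flat and `N` is an increasing union of submodules `P k` with `Q ⊗ P k` flat, then
`Q ⊗ N` is flat. -/
theorem Module.Flat.tensorProduct_of_monotone {A Q N : Type*} [CommRing A]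
    [AddCommGroup Q] [Module A Q] [Module.Flat A Q] [AddCommGroup N] [Module A N]
    (P : ℕ → Submodule A N) (hP : Monotone P) (hx : ∀ x, ∃ k, x ∈ P k)
    (h : ∀ k, Module.Flat A (Q ⊗[A] P k)) : Module.Flat A (Q ⊗[A] N) := by
  have key (X : Type _) [AddCommGroup X] [Module A X] (x : X ⊗[A] (Q ⊗[A] N)) :
      ∃ k y, ((P k).subtype.lTensor Q).lTensor X y = x := by
    have mono {k l : ℕ} (hkl : k ≤ l) (y : X ⊗[A] (Q ⊗[A] P k)) :
        ∃ z, ((P l).subtype.lTensor Q).lTensor X z = ((P k).subtype.lTensor Q).lTensor X y := by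
      refine ⟨((Submodule.inclusion (hP hkl)).lTensor Q).lTensor X y, ?_⟩
      rw [← LinearMap.comp_apply, ← LinearMap.lTensor_comp, ← LinearMap.lTensor_comp,
        Submodule.subtype_comp_inclusion]
    induction x with
    | zero => exact ⟨0, 0, map_zero _⟩
    | add x y hx hy =>
      obtain ⟨k, x', rfl⟩ := hx
      obtain ⟨l, y', rfl⟩ := hy
      obtain ⟨u, hu⟩ := mono (le_max_left k l) x'
      obtain ⟨v, hv⟩ := mono (le_max_right k l) y'
      exact ⟨max k l, u + v, by rw [map_add, hu, hv]⟩
    | tmul a t =>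
      induction t with
      | zero => exact ⟨0, 0, by simp⟩
      | add x y hx hy =>
        obtain ⟨k, x', hx'⟩ := hx
        obtain ⟨l, y', hy'⟩ := hy
        obtain ⟨u, hu⟩ := mono (le_max_left k l) x'
        obtain ⟨v, hv⟩ := mono (le_max_right k l) y'
        exact ⟨max k l, u + v, by rw [map_add, hu, hv, hx', hy', TensorProduct.tmul_add]⟩
      | tmul q n =>
        obtain ⟨k, hk⟩ := hx n
        exact ⟨k, a ⊗ₜ (q ⊗ₜ ⟨n, hk⟩), by simp⟩
  rw [Module.Flat.iff_rTensor_injective']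
  intro I
  rw [injective_iff_map_eq_zero]
  intro x hx
  obtain ⟨k, y, rfl⟩ := key I x
  have := h k
  have hy : I.subtype.rTensor (Q ⊗[A] P k) y = 0 := by
    have hinj := Module.Flat.lTensor_preserves_injective_linearMap (M := A) _
      (Module.Flat.lTensor_preserves_injective_linearMap (M := Q) (P k).subtype
        (P k).injective_subtype)
    apply hinj
    rw [map_zero, ← hx, ← LinearMap.comp_apply, ← LinearMap.comp_apply,
      LinearMap.rTensor_comp_lTensor, LinearMap.lTensor_comp_rTensor]
  rw [(injective_iff_map_eq_zero _).1 (Module.Flat.rTensor_preserves_injective_linearMap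
    (M := Q ⊗[A] P k) I.subtype I.injective_subtype) y hy, map_zero]

/-- `N` is flat over a nonempty basic open subset of `Spec A`. -/
def IsGenericallyFlat (A N : Type*) [CommRing A] [AddCommGroup N] [Module A N] : Prop :=
  ∃ f : A, f ≠ 0 ∧ ∀ q : PrimeSpectrum A, f ∉ q.asIdeal →
    Module.Flat A (Localization.AtPrime q.asIdeal ⊗[A] N)

theorem Module.Flat.tensorProduct_of_linearEquiv {A Q N N' : Type*} [CommRing A]
    [AddCommGroup Q] [Module A Q] [AddCommGroup N] [Module A N] [AddCommGroup N'] [Module A N']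
    (e : N ≃ₗ[A] N') [Module.Flat A (Q ⊗[A] N)] : Module.Flat A (Q ⊗[A] N') :=
  .of_linearEquiv (e.symm.lTensor Q)

/-- An `ℕ`-indexed exhaustive filtration whose successive quotients are flat after tensoring with
a flat module. -/
theorem Module.Flat.tensorProduct_of_filtration {A Q N : Type*} [CommRing A]
    [AddCommGroup Q] [Module A Q] [Module.Flat A Q] [AddCommGroup N] [Module A N]
    (P : ℕ → Submodule A N) (h₀ : P 0 = ⊥) (hP : Monotone P) (hx : ∀ x, ∃ k, x ∈ P k)
    (h : ∀ k, Module.Flat A (Q ⊗[A] (P (k + 1) ⧸ (P k).submoduleOf (P (k + 1))))) :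
    Module.Flat A (Q ⊗[A] N) := by
  refine .tensorProduct_of_monotone P hP hx fun k ↦ ?_
  induction k with
  | zero =>
    have : Subsingleton (P 0) := by rw [h₀]; infer_instance
    infer_instance
  | succ k ih =>
    have := h k
    have hex : Function.Exact (Submodule.inclusion (hP k.le_succ))
        ((P k).submoduleOf (P (k + 1))).mkQ := by
      rw [LinearMap.exact_iff, Submodule.ker_mkQ, Submodule.range_inclusion]
      rfl
    have hsurj := ((P k).submoduleOf (P (k + 1))).mkQ_surjective
    exact .of_exact _ _ (_root_.lTensor_exact Q hex hsurj) (LinearMap.lTensor_surjective Q hsurj)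
      (Module.Flat.lTensor_preserves_injective_linearMap _
        (Submodule.inclusion_injective (hP k.le_succ)))

theorem IsGenericallyFlat.of_finite {A N : Type*} [CommRing A] [IsDomain A] [IsNoetherianRing A]
    [AddCommGroup N] [Module A N] [Module.Finite A N] : IsGenericallyFlat A N := by
  have : Module.FinitePresentation A N := Module.finitePresentation_of_finite A N
  have hbot : (⊥ : PrimeSpectrum A) ∈ Module.freeLocus A N := by
    have : IsLocalization.AtPrime (FractionRing A) (⊥ : PrimeSpectrum A).asIdeal := by
      simpa only [IsLocalization.AtPrime, PrimeSpectrum.asIdeal_bot, Ideal.primeCompl_bot] using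
        (inferInstance : IsFractionRing A (FractionRing A))
    exact (Module.mem_freeLocus_iff_tensor ⊥ (FractionRing A)).2 inferInstance
  obtain ⟨_, ⟨f, rfl⟩, hf, hsub⟩ :=
    PrimeSpectrum.isTopologicalBasis_basic_opens.exists_subset_of_mem_open hbot
      Module.isOpen_freeLocus
  refine ⟨f, fun h ↦ hf (by simp [h]), fun q hq ↦ ?_⟩
  have := (Module.mem_freeLocus_iff_tensor q (Localization.AtPrime q.asIdeal)).1 (hsub hq)
  exact .trans A (Localization.AtPrime q.asIdeal) _

theorem exists_forall_flat_quotient_of_monotone {A B N : Type*} [CommRing A] [IsDomain A]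
    [CommRing B] [Algebra A B] [AddCommGroup N] [Module A N] [Module B N] [IsScalarTower A B N]
    [IsNoetherian B N] (K : ℕ →o Submodule B N) (h : ∀ k, IsGenericallyFlat A (N ⧸ K k)) :
    ∃ f : A, f ≠ 0 ∧ ∀ q : PrimeSpectrum A, f ∉ q.asIdeal → ∀ k,
      Module.Flat A (Localization.AtPrime q.asIdeal ⊗[A] (N ⧸ K k)) := by
  obtain ⟨n, hn⟩ := monotone_stabilizes_iff_noetherian.2 ‹_› K
  choose f hf₀ hf using h
  refine ⟨∏ k ∈ Finset.range (n + 1), f k, Finset.prod_ne_zero_iff.2 fun k _ ↦ hf₀ k,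
    fun q hq k ↦ ?_⟩
  have main (k : ℕ) (hk : k ≤ n) :
      Module.Flat A (Localization.AtPrime q.asIdeal ⊗[A] (N ⧸ K k)) :=
    hf k q fun h ↦ hq (Ideal.mem_of_dvd _
      (Finset.dvd_prod_of_mem f (Finset.mem_range.2 (Nat.lt_succ_of_le hk))) h)
  rcases le_total k n with hk | hk
  · exact main k hk
  · rw [← hn k hk]
    exact main n le_rfl

open Polynomial in
theorem IsGenericallyFlat.of_finite_polynomial {A B N : Type*} [CommRing A] [IsDomain A]
    [CommRing B] [IsNoetherianRing B] [Algebra A B] [AddCommGroup N] [Module A N] [Module B N]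
    [Module B[X] N] [IsScalarTower A B N] [IsScalarTower B B[X] N] [Module.Finite B[X] N]
    (h : ∀ (V : Submodule B N) (_ : V.FG) (W : Submodule B V), IsGenericallyFlat A (V ⧸ W)) :
    IsGenericallyFlat A N := by
  obtain ⟨S, hS⟩ := Module.Finite.fg_top (R := B[X]) (M := N)
  let φ : N →ₗ[B] N := (LinearMap.lsmul B[X] N X).restrictScalars B
  let V : Submodule B N := Submodule.span B S
  have hVfg : V.FG := ⟨S, rfl⟩
  have : IsNoetherian B V := isNoetherian_of_fg_of_noetherian V hVfg
  obtain ⟨F, hF₀, hF₁⟩ : ∃ F : ℕ → Submodule B N, F 0 = ⊥ ∧ ∀ k, F (k + 1) = V ⊔ (F k).map φ :=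
    ⟨fun k ↦ Nat.rec ⊥ (fun _ P ↦ V ⊔ P.map φ) k, rfl, fun _ ↦ rfl⟩
  have hF₂ (k : ℕ) : F (k + 1) = F k ⊔ V.map (φ ^ k) := by
    induction k with
    | zero => simp [hF₁, hF₀, Module.End.one_eq_id]
    | succ k ih =>
      conv_lhs => rw [hF₁ (k + 1), ih, Submodule.map_sup, ← sup_assoc, ← hF₁, ← Submodule.map_comp]
      rw [pow_succ', Module.End.mul_eq_comp]
  have hFmono : Monotone F := monotone_nat_of_le_succ fun k ↦ hF₂ k ▸ le_sup_left
  have hVF (k : ℕ) : V.map (φ ^ k) ≤ F (k + 1) := hF₂ k ▸ le_sup_right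
  have hFφ (k : ℕ) : (F k).map φ ≤ F (k + 1) := hF₁ k ▸ le_sup_right
  have hFx (x : N) : ∃ k, x ∈ F k := by
    have hx : x ∈ Submodule.span B[X] (S : Set N) := hS ▸ Submodule.mem_top
    induction hx using Submodule.span_induction with
    | mem x hx => exact ⟨1, hF₁ 0 ▸ Submodule.mem_sup_left (Submodule.subset_span hx)⟩
    | zero => exact ⟨0, zero_mem _⟩
    | add x y _ _ hx hy =>
      obtain ⟨k, hk⟩ := hx
      obtain ⟨l, hl⟩ := hy
      exact ⟨max k l, add_mem (hFmono (le_max_left k l) hk) (hFmono (le_max_right k l) hl)⟩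
    | smul p x _ hx =>
      induction p using Polynomial.induction_on' with
      | add p r hp hr =>
        obtain ⟨k, hk⟩ := hp
        obtain ⟨l, hl⟩ := hr
        exact ⟨max k l, add_smul p r x ▸
          add_mem (hFmono (le_max_left k l) hk) (hFmono (le_max_right k l) hl)⟩
      | monomial n b =>
        obtain ⟨k, hk⟩ := hx
        refine ⟨k + n, ?_⟩
        rw [← C_mul_X_pow_eq_monomial, ← smul_eq_C_mul, smul_assoc]
        refine Submodule.smul_mem _ _ ?_
        induction n with
        | zero => simpa using hk
        | succ n ih =>
          rw [pow_succ', mul_smul]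
          exact hFφ (k + n) (Submodule.mem_map_of_mem ih)
  let K : ℕ →o Submodule B V :=
    ⟨fun k ↦ (F k).comap ((φ ^ k).comp V.subtype), monotone_nat_of_le_succ fun k v hv ↦ by
      simp only [Submodule.mem_comap, LinearMap.comp_apply, pow_succ'] at hv ⊢
      exact hFφ k (Submodule.mem_map_of_mem hv)⟩
  obtain ⟨f, hf₀, hf⟩ := exists_forall_flat_quotient_of_monotone (A := A) K fun k ↦ h V hVfg (K k)
  refine ⟨f, hf₀, fun q hq ↦ ?_⟩
  refine .tensorProduct_of_filtration (fun k ↦ (F k).restrictScalars A) (by simp [hF₀])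
    (fun k l hkl ↦ hFmono hkl) hFx fun k ↦ ?_
  have := hf q hq k
  let ψ : V →ₗ[B] (F (k + 1) ⧸ (F k).submoduleOf (F (k + 1))) :=
    ((F k).submoduleOf (F (k + 1))).mkQ ∘ₗ
      ((φ ^ k).comp V.subtype).codRestrict (F (k + 1))
        fun v ↦ hVF k (Submodule.mem_map_of_mem v.2)
  have hker : LinearMap.ker ψ = K k := by
    ext v
    exact Submodule.Quotient.mk_eq_zero _
  have hsurj : Function.Surjective ψ := by
    intro y
    obtain ⟨⟨y, hy⟩, rfl⟩ := Submodule.mkQ_surjective _ y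
    obtain ⟨z, hz, w, hw, rfl⟩ := Submodule.mem_sup.1 (hF₂ k ▸ hy)
    obtain ⟨v, hv, rfl⟩ := hw
    refine ⟨⟨v, hv⟩, (Submodule.Quotient.eq _).2 ?_⟩
    simpa [Submodule.submoduleOf] using hz
  let e := (Submodule.quotEquivOfEq _ _ hker.symm ≪≫ₗ
    ψ.quotKerEquivOfSurjective hsurj).restrictScalars A
  exact .tensorProduct_of_linearEquiv e

theorem Module.Finite.of_smul_eq_of_surjective {R S N : Type*} [CommRing R] [CommRing S]
    [AddCommGroup N] [Module R N] [Module S N] [Module.Finite S N] (π : R →+* S)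
    (hπ : Function.Surjective π) (h : ∀ (r : R) (x : N), r • x = π r • x) :
    Module.Finite R N := by
  let := π.toAlgebra
  have : IsScalarTower R S N := .of_algebraMap_smul fun r x ↦ (h r x).symm
  have : Module.Finite R S := .of_surjective (Algebra.linearMap R S) hπ
  exact .trans S N

theorem IsGenericallyFlat.of_finite_mvPolynomial {A : Type*} [CommRing A] [IsDomain A]
    [IsNoetherianRing A] (n : ℕ) : ∀ (N : Type*) [AddCommGroup N] [Module A N]
    [Module (MvPolynomial (Fin n) A) N] [IsScalarTower A (MvPolynomial (Fin n) A) N]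
    [Module.Finite (MvPolynomial (Fin n) A) N], IsGenericallyFlat A N := by
  induction n with
  | zero =>
    intro N _ _ _ _ _
    have : Module.Finite A (MvPolynomial (Fin 0) A) :=
      .equiv (MvPolynomial.isEmptyAlgEquiv A (Fin 0)).symm.toLinearEquiv
    have : Module.Finite A N := .trans (MvPolynomial (Fin 0) A) N
    exact .of_finite
  | succ n ih =>
    intro N _ _ _ _ _
    let e := (MvPolynomial.finSuccEquiv A n).symm
    let : Module (Polynomial (MvPolynomial (Fin n) A)) N := Module.compHom N e.toRingHom
    let : Module (MvPolynomial (Fin n) A) N :=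
      Module.compHom N (Polynomial.C : MvPolynomial (Fin n) A →+* _)
    have he (p : Polynomial (MvPolynomial (Fin n) A)) (x : N) : p • x = e p • x := rfl
    have hC (b : MvPolynomial (Fin n) A) (x : N) : b • x = Polynomial.C b • x := rfl
    have : IsScalarTower (MvPolynomial (Fin n) A) (Polynomial (MvPolynomial (Fin n) A)) N :=
      ⟨fun b p x ↦ by rw [hC, Polynomial.smul_eq_C_mul, mul_smul]⟩
    have : IsScalarTower A (MvPolynomial (Fin n) A) N :=
      ⟨fun a b x ↦ by
        rw [hC, hC, he, he, ← smul_assoc, ← map_smul, Polynomial.smul_C]⟩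
    have : Module.Finite (Polynomial (MvPolynomial (Fin n) A)) N :=
      .of_smul_eq_of_surjective e.toRingHom e.surjective he
    refine .of_finite_polynomial (B := MvPolynomial (Fin n) A) fun V hV W ↦ ?_
    have : Module.Finite (MvPolynomial (Fin n) A) V := .of_fg hV
    exact ih _

/-- Generic flatness. -/
theorem IsGenericallyFlat.of_finiteType {A R N : Type*} [CommRing A] [IsDomain A]
    [IsNoetherianRing A] [CommRing R] [Algebra A R] [Algebra.FiniteType A R] [AddCommGroup N]
    [Module A N] [Module R N] [IsScalarTower A R N] [Module.Finite R N] :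
    IsGenericallyFlat A N := by
  obtain ⟨n, π, hπ⟩ := Algebra.FiniteType.iff_quotient_mvPolynomial''.1 ‹Algebra.FiniteType A R›
  let : Module (MvPolynomial (Fin n) A) N := Module.compHom N π.toRingHom
  have hsmul (p : MvPolynomial (Fin n) A) (x : N) : p • x = π p • x := rfl
  have : IsScalarTower A (MvPolynomial (Fin n) A) N :=
    ⟨fun a p x ↦ by rw [hsmul, hsmul, map_smul, smul_assoc]⟩
  have : Module.Finite (MvPolynomial (Fin n) A) N :=
    .of_smul_eq_of_surjective π.toRingHom hπ hsmul
  exact .of_finite_mvPolynomial n N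

/-- An injective endomorphism whose cokernel is flat at `q` stays injective after base change
to any `A`-algebra in which the elements outside `q` are invertible. -/
theorem LinearMap.lTensor_injective_of_flat_localization {A M P : Type*} [CommRing A]
    [AddCommGroup M] [Module A M] [AddCommGroup P] [Module A P]
    (g : M →ₗ[A] M) (hg : Function.Injective g) (p : M →ₗ[A] P) (hp : Function.Surjective p)
    (hgp : Function.Exact g p) (q : Ideal A) [q.IsPrime]
    [Module.Flat A (Localization.AtPrime q ⊗[A] P)] {K : Type*} [CommRing K] [Algebra A K]
    (hK : ∀ s : q.primeCompl, IsUnit (algebraMap A K s)) :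
    Function.Injective (g.lTensor K) := by
  let Q := Localization.AtPrime q
  let l : Q →ₐ[A] K := IsLocalization.liftAlgHom (M := q.primeCompl) (f := Algebra.ofId A K) hK
  have hinj := LinearMap.lTensor_injective_of_exact_of_flat (p.lTensor Q)
    (LinearMap.lTensor_surjective Q hp) (g.lTensor Q)
    (Module.Flat.lTensor_preserves_injective_linearMap g hg) (_root_.lTensor_exact Q hgp hp) K
  let ι : K ⊗[A] M →ₗ[A] K ⊗[A] (Q ⊗[A] M) := (TensorProduct.mk A Q M 1).lTensor K
  let r : K ⊗[A] (Q ⊗[A] M) →ₗ[A] K ⊗[A] M :=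
    (LinearMap.mul' A K ∘ₗ l.toLinearMap.lTensor K).rTensor M ∘ₗ
      (TensorProduct.assoc A K Q M).symm.toLinearMap
  have hr : r ∘ₗ ι = LinearMap.id := by
    ext
    simp [r, ι]
  have hι : ((g.lTensor Q).lTensor K).comp ι = ι.comp (g.lTensor K) := by
    ext
    simp [ι]
  have : Function.Injective (ι ∘ₗ g.lTensor K) := by
    rw [← hι]
    exact hinj.comp (Function.LeftInverse.injective (g := r) (LinearMap.congr_fun hr))
  exact Function.Injective.of_comp this

/-- Let `A → R` be a finite type map of Noetherian rings with `A` a domain, and `M` a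
finitely generated `R`-module.  If `c ∈ R` is a nonzerodivisor on `M`, then the locus of
primes `𝔭` of `A` such that `c` is a nonzerodivisor on `M ⊗_A κ(𝔭)` contains a nonempty
open subset of `Spec A`. -/
theorem stmt12 {A R : Type*} [CommRing A] [IsDomain A] [IsNoetherianRing A]
    [CommRing R] [IsNoetherianRing R] [Algebra A R] [Algebra.FiniteType A R]
    (M : Type*) [AddCommGroup M] [Module R M] [Module A M] [IsScalarTower A R M]
    [Module.Finite R M]
    (c : R) (hc : ∀ m : M, c • m = 0 → m = 0) :
    ∃ U : Set (PrimeSpectrum A), IsOpen U ∧ U.Nonempty ∧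
      ∀ q ∈ U, Function.Injective
        (LinearMap.baseChange (FractionRing (A ⧸ q.asIdeal))
          (LinearMap.restrictScalars A (LinearMap.lsmul R M c))) := by
  let P := LinearMap.range (LinearMap.lsmul R M c)
  obtain ⟨f, hf₀, hf⟩ : IsGenericallyFlat A (M ⧸ P) := .of_finiteType (R := R)
  refine ⟨PrimeSpectrum.basicOpen f, (PrimeSpectrum.basicOpen f).2, ⟨⊥, hf₀⟩, fun q hq ↦ ?_⟩
  have := hf q hq
  refine LinearMap.lTensor_injective_of_flat_localization
    ((LinearMap.lsmul R M c).restrictScalars A)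
    ((injective_iff_map_eq_zero _).2 hc) (P.mkQ.restrictScalars A) P.mkQ_surjective
    (LinearMap.exact_map_mkQ_range (LinearMap.lsmul R M c)) q.asIdeal fun s ↦ ?_
  refine IsUnit.mk0 _ fun h ↦ s.2 ?_
  refine Ideal.Quotient.eq_zero_iff_mem.1 ?_
  exact (FaithfulSMul.algebraMap_injective (A ⧸ q.asIdeal) (FractionRing (A ⧸ q.asIdeal)))
    (h.trans (map_zero _).symm)
end

section
/- Let $X$ be a biequidimensional Noetherian scheme, i.e., all maximal chains of irreducible closed subsets of $X$ have the same length. Then for every point $x \in X$, the local scheme $\Spec(\mathcal{O}_{X,x})$ is biequidimensional; in particular $X$ is locally equidimensional. -/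
open AlgebraicGeometry

/-- A topological space is biequidimensional if all maximal chains of irreducible closed
subsets have the same length (cardinality). -/
def TopBiequidim (α : Type*) [TopologicalSpace α] : Prop :=
  ∀ c c' : Set {s : Set α // IsClosed s ∧ IsIrreducible s},
    IsMaxChain (· ≤ ·) c → IsMaxChain (· ≤ ·) c' → c.ncard = c'.ncard

/-- A commutative ring is equidimensional if all its minimal primes have quotients of the
same dimension `dim A`. -/
def RingEquidim (A : Type*) [CommRing A] : Prop :=
  ∀ P ∈ minimalPrimes A, ringKrullDim (A ⧸ P) = ringKrullDim A

open TopologicalSpace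

/-- All maximal chains of an order have the same (natural) cardinality. -/
def MaxChainsEquicard (P : Type*) [LE P] : Prop :=
  ∀ c c' : Set P, IsMaxChain (· ≤ ·) c → IsMaxChain (· ≤ ·) c' → c.ncard = c'.ncard

lemma MaxChainsEquicard.of_orderIso {P Q : Type*} [LE P] [LE Q] (e : P ≃o Q)
    (h : MaxChainsEquicard Q) : MaxChainsEquicard P := fun c c' hc hc' ↦ by
  rw [← Set.ncard_image_of_injective c e.injective, ← Set.ncard_image_of_injective c' e.injective]
  exact h _ _ (hc.image e) (hc'.image e)

lemma MaxChainsEquicard.orderDual {P : Type*} [LE P] (h : MaxChainsEquicard P) :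
    MaxChainsEquicard Pᵒᵈ :=
  fun c c' hc hc' ↦ h c c' hc.symm hc'.symm

lemma topBiequidim_iff_maxChainsEquicard (α : Type*) [TopologicalSpace α] :
    TopBiequidim α ↔ MaxChainsEquicard (IrreducibleCloseds α) :=
  ⟨fun h ↦ .of_orderIso (IrreducibleCloseds.orderIsoSubtype' α) h,
    fun h ↦ MaxChainsEquicard.of_orderIso (IrreducibleCloseds.orderIsoSubtype' α).symm h⟩

section Chains

variable {P Q : Type*} [PartialOrder P] [PartialOrder Q]

lemma IsMaxChain.mem_of_forall_le {c : Set P} (hc : IsMaxChain (· ≤ ·) c) {a : P}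
    (ha : ∀ b, a ≤ b) : a ∈ c := by
  rw [hc.2 (hc.isChain.insert fun b _ _ ↦ .inl (ha b)) (Set.subset_insert a c)]
  exact Set.mem_insert a c

/-- If `f` identifies `P` with the elements above `a`, gluing a maximal chain of `P` with a
maximal chain of elements below `a` gives a maximal chain. -/
lemma IsMaxChain.image_union_image_Iic (f : P ↪o Q) {a : Q} (hf : Set.range f = Set.Ici a)
    {c : Set P} (hc : IsMaxChain (· ≤ ·) c) {d : Set (Set.Iic a)} (hd : IsMaxChain (· ≤ ·) d) :
    IsMaxChain (· ≤ ·) (f '' c ∪ Subtype.val '' d) := by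
  have hfa (p : P) : a ≤ f p := hf.le ⟨p, rfl⟩
  refine ⟨isChain_union.2 ⟨hc.isChain.image f,
    hd.isChain.image (OrderEmbedding.subtype _), ?_⟩, fun t ht hct ↦ hct.antisymm ?_⟩
  · rintro _ ⟨p, -, rfl⟩ _ ⟨q, -, rfl⟩ -
    exact .inr (q.2.trans (hfa p))
  · obtain ⟨p₀, hp₀⟩ : a ∈ Set.range f := hf.ge le_rfl
    have hc' : c = f ⁻¹' t :=
      hc.2 (ht.preimage_relEmbedding f) fun p hp ↦ hct (.inl ⟨p, hp, rfl⟩)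
    have hd' : d = Subtype.val ⁻¹' t :=
      hd.2 (ht.preimage_relEmbedding (OrderEmbedding.subtype _)) fun q hq ↦ hct (.inr ⟨q, hq, rfl⟩)
    have hp₀c : p₀ ∈ c :=
      hc.mem_of_forall_le fun b ↦ f.le_iff_le.1 (hp₀.le.trans (hfa b))
    have hat : a ∈ t := hp₀ ▸ hct (.inl ⟨p₀, hp₀c, rfl⟩)
    intro e he
    rcases ht.total he hat with h | h
    · exact .inr ⟨⟨e, h⟩, hd' ▸ he, rfl⟩
    · obtain ⟨p, rfl⟩ : e ∈ Set.range f := hf.ge h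
      exact .inl ⟨p, hc' ▸ he, rfl⟩

lemma ncard_image_union_image_Iic (f : P ↪o Q) {a : Q} (hf : Set.range f = Set.Ici a)
    {c : Set P} (hc : IsMaxChain (· ≤ ·) c) {d : Set (Set.Iic a)} (hd : IsMaxChain (· ≤ ·) d)
    (hcf : c.Finite) (hdf : d.Finite) :
    (f '' c ∪ Subtype.val '' d).ncard + 1 = c.ncard + d.ncard := by
  have hfa (p : P) : a ≤ f p := hf.le ⟨p, rfl⟩
  obtain ⟨p₀, hp₀⟩ : a ∈ Set.range f := hf.ge le_rfl
  have hp₀c : p₀ ∈ c :=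
    hc.mem_of_forall_le fun b ↦ f.le_iff_le.1 (hp₀.le.trans (hfa b))
  have hinter : f '' c ∩ Subtype.val '' d = {a} := by
    refine Set.Subset.antisymm ?_ (Set.singleton_subset_iff.2
      ⟨⟨p₀, hp₀c, hp₀⟩, ⟨a, le_rfl⟩, hd.top_mem, rfl⟩)
    rintro _ ⟨⟨p, -, rfl⟩, q, -, hq⟩
    exact le_antisymm (hq ▸ q.2) (hfa p)
  have := Set.ncard_union_add_ncard_inter (f '' c) (Subtype.val '' d) (hcf.image _) (hdf.image _)
  rwa [hinter, Set.ncard_singleton, Set.ncard_image_of_injective _ f.injective,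
    Set.ncard_image_of_injective _ Subtype.val_injective] at this

lemma exists_isMaxChain (P : Type*) [LE P] : ∃ c : Set P, IsMaxChain (· ≤ ·) c :=
  let ⟨c, hc, _⟩ := (IsChain.empty (r := ((· ≤ ·) : P → P → Prop))).exists_maxChain
  ⟨c, hc⟩

lemma MaxChainsEquicard.of_range_eq_Ici (h : MaxChainsEquicard Q)
    (hfin : ∀ c : Set Q, IsChain (· ≤ ·) c → c.Finite) (f : P ↪o Q) {a : Q}
    (hf : Set.range f = Set.Ici a) : MaxChainsEquicard P := fun c c' hc hc' ↦ by
  obtain ⟨d, hd⟩ := exists_isMaxChain (Set.Iic a)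
  have hfinP {s : Set P} (hs : IsMaxChain (· ≤ ·) s) : s.Finite :=
    .of_finite_image (hfin _ (hs.isChain.image f)) f.injective.injOn
  have hdf : d.Finite :=
    .of_finite_image (hfin _ (hd.isChain.image (OrderEmbedding.subtype _)))
      Subtype.val_injective.injOn
  have h₁ := ncard_image_union_image_Iic f hf hc hd (hfinP hc) hdf
  have h₂ := ncard_image_union_image_Iic f hf hc' hd (hfinP hc') hdf
  have h₃ := h _ _ (hc.image_union_image_Iic f hf hd) (hc'.image_union_image_Iic f hf hd)
  lia

lemma IsChain.exists_ltSeries_length_add_one_eq_card {t : Finset P}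
    (ht : IsChain (· ≤ ·) (t : Set P)) (hne : t.Nonempty) :
    ∃ p : LTSeries P, p.length + 1 = t.card := by
  classical
  let _ : LinearOrder t :=
    { (inferInstance : PartialOrder t) with
      le_total := fun x y ↦ ht.total x.2 y.2
      toDecidableLE := Classical.decRel _ }
  obtain ⟨n, hn⟩ : ∃ n, t.card = n + 1 := ⟨t.card - 1, by have := hne.card_pos; lia⟩
  let e : Fin (n + 1) ≃o t := Fintype.orderIsoFinOfCardEq t (by simpa using hn)
  exact ⟨LTSeries.mk n (fun i ↦ (e i : P)) fun i j hij ↦ e.strictMono hij, hn.symm⟩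

lemma IsChain.finite_of_finiteDimensionalOrder [FiniteDimensionalOrder P] {c : Set P}
    (hc : IsChain (· ≤ ·) c) : c.Finite := by
  by_contra hinf
  obtain ⟨t, htc, ht⟩ :=
    Set.Infinite.exists_subset_card_eq hinf ((LTSeries.longestOf P).length + 2)
  obtain ⟨p, hp⟩ := (hc.mono htc).exists_ltSeries_length_add_one_eq_card
    (Finset.card_pos.1 (by lia))
  have : p.length ≤ (LTSeries.longestOf P).length := p.length_le_length_longestOf
  lia

lemma MaxChainsEquicard.krullDim_eq [FiniteDimensionalOrder P] (h : MaxChainsEquicard P)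
    {c : Set P} (hc : IsMaxChain (· ≤ ·) c) : Order.krullDim P = (c.ncard - 1 : ℕ) := by
  have hcf := hc.isChain.finite_of_finiteDimensionalOrder
  have : Nonempty P := ⟨(LTSeries.longestOf P).head⟩
  apply le_antisymm
  · refine iSup_le fun p ↦ ?_
    obtain ⟨s, hs, hps⟩ := (p.strictMono.monotone.isChain_range).exists_maxChain
    have hle := Set.ncard_le_ncard hps hs.isChain.finite_of_finiteDimensionalOrder
    rw [h s c hs hc, ← Set.image_univ, Set.ncard_image_of_injective _ p.strictMono.injective,
      Set.ncard_univ, Nat.card_eq_fintype_card, Fintype.card_fin] at hle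
    exact_mod_cast Nat.le_sub_one_of_lt hle
  · obtain ⟨p, hp⟩ := IsChain.exists_ltSeries_length_add_one_eq_card (t := hcf.toFinset)
      (by simpa using hc.isChain) (by simpa using hc.nonempty_iff.1 ‹_›)
    rw [← Set.ncard_eq_toFinset_card c hcf] at hp
    rw [← hp, Nat.add_sub_cancel]
    exact Order.LTSeries.length_le_krullDim p

lemma MaxChainsEquicard.krullDim_eq_of_range_eq_Ici [FiniteDimensionalOrder Q]
    (h : MaxChainsEquicard Q) (f : P ↪o Q) {a : Q} (ha : IsMin a)
    (hf : Set.range f = Set.Ici a) : Order.krullDim P = Order.krullDim Q := by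
  have hfin (c : Set Q) (hc : IsChain (· ≤ ·) c) : c.Finite :=
    hc.finite_of_finiteDimensionalOrder
  have : FiniteDimensionalOrder P := by
    rw [Order.finiteDimensionalOrder_iff_krullDim_ne_bot_and_top]
    obtain ⟨p₀, -⟩ : a ∈ Set.range f := hf.ge le_rfl
    have : Nonempty P := ⟨p₀⟩
    exact ⟨Order.krullDim_ne_bot_iff.2 this,
      ne_top_of_le_ne_top Order.krullDim_ne_top_of_finiteDimensionalOrder
        (Order.krullDim_le_of_strictMono f f.strictMono)⟩
  obtain ⟨c, hc⟩ := exists_isMaxChain P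
  obtain ⟨d, hd⟩ := exists_isMaxChain (Set.Iic a)
  have hd1 : d.ncard = 1 := by
    refine Set.ncard_eq_one.2 ⟨⊤, Set.eq_singleton_iff_unique_mem.2 ⟨hd.top_mem, fun x _ ↦ ?_⟩⟩
    exact Subtype.ext (le_antisymm x.2 (ha x.2))
  have := ncard_image_union_image_Iic f hf hc hd hc.isChain.finite_of_finiteDimensionalOrder
    (Set.finite_of_ncard_ne_zero (by lia))
  rw [(h.of_range_eq_Ici hfin f hf).krullDim_eq hc,
    h.krullDim_eq (hc.image_union_image_Iic f hf hd)]
  congr 2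
  lia

/-- In a well-founded order whose principal upper sets have only finite chains, every chain is
finite. -/
lemma IsChain.finite_of_forall_Ici [WellFoundedLT Q]
    (h : ∀ a : Q, ∀ c ⊆ Set.Ici a, IsChain (· ≤ ·) c → c.Finite) {c : Set Q}
    (hc : IsChain (· ≤ ·) c) : c.Finite := by
  rcases c.eq_empty_or_nonempty with rfl | hne
  · exact Set.finite_empty
  · refine h (wellFounded_lt.min c hne) c (fun x hx ↦ ?_) hc
    exact (hc.total (wellFounded_lt.min_mem c hne) hx).elim id fun hle ↦
      (eq_of_le_of_not_lt hle (wellFounded_lt.not_lt_min c hx)).ge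

end Chains

lemma RingEquidim.of_maxChainsEquicard {A : Type*} [CommRing A] [FiniteRingKrullDim A]
    (h : MaxChainsEquicard (PrimeSpectrum A)) : RingEquidim A := fun P hP ↦ by
  have hPp : P.IsPrime := Ideal.IsMinimalPrime.isPrime hP
  rw [ringKrullDim_quotient]
  refine h.krullDim_eq_of_range_eq_Ici (OrderEmbedding.subtype _) (a := ⟨P, hPp⟩) ?_ ?_
  · exact fun q hq ↦ hP.2 ⟨q.2, bot_le⟩ hq
  · ext q
    simp [PrimeSpectrum.mem_zeroLocus, ← PrimeSpectrum.asIdeal_le_asIdeal]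

/-- The specialization order on the points of a scheme. -/
instance schemePartialOrder (X : Scheme) : PartialOrder X := specializationOrder X

/-- The prime spectrum of the stalk at `x`, as the order of generizations of `x`. -/
noncomputable def stalkSpecOrderEmbedding (X : Scheme) (x : X) :
    (PrimeSpectrum (X.presheaf.stalk x))ᵒᵈ ↪o X :=
  OrderEmbedding.ofMapLEIff (fun p ↦ X.fromSpecStalk x (OrderDual.ofDual p)) fun _ _ ↦
    ((X.fromSpecStalk x).isEmbedding.isInducing.specializes_iff).trans
      (PrimeSpectrum.le_iff_specializes _ _).symm

lemma range_stalkSpecOrderEmbedding (X : Scheme) (x : X) :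
    Set.range (stalkSpecOrderEmbedding X x) = Set.Ici x :=
  Scheme.range_fromSpecStalk

lemma wellFoundedLT_of_isNoetherian (X : Scheme) [IsNoetherian X] : WellFoundedLT X :=
  have : WellFoundedLT (IrreducibleCloseds X) :=
    StrictMono.wellFoundedLT (f := fun s : IrreducibleCloseds X ↦ (⟨s, s.isClosed⟩ : Closeds X))
      fun _ _ h ↦ h
  (irreducibleSetEquivPoints (α := X)).symm.strictMono.wellFoundedLT

/-- If `X` is a biequidimensional Noetherian scheme, then for every point `x ∈ X` the
local scheme `Spec 𝒪_{X,x}` is biequidimensional; in particular `X` is locally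
equidimensional. -/
theorem stmt15 (X : Scheme) [IsNoetherian X] (hX : TopBiequidim X) :
    ∀ x : X, TopBiequidim (PrimeSpectrum (X.presheaf.stalk x)) ∧
      RingEquidim (X.presheaf.stalk x) := by
  intro x
  have := wellFoundedLT_of_isNoetherian X
  have hX' : MaxChainsEquicard X :=
    .of_orderIso (irreducibleSetEquivPoints (α := X)).symm
      ((topBiequidim_iff_maxChainsEquicard X).1 hX)
  have hfin (c : Set X) (hc : IsChain (· ≤ ·) c) : c.Finite := by
    refine hc.finite_of_forall_Ici fun a s hsa hs ↦ ?_
    rw [← range_stalkSpecOrderEmbedding] at hsa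
    rw [← Set.image_preimage_eq_of_subset hsa]
    have hs' := (hs.preimage_relEmbedding (stalkSpecOrderEmbedding X a)).symm
    exact (IsChain.finite_of_finiteDimensionalOrder
      (P := PrimeSpectrum (X.presheaf.stalk a)) hs').image _
  have hdual := hX'.of_range_eq_Ici hfin _ (range_stalkSpecOrderEmbedding X x)
  refine ⟨(topBiequidim_iff_maxChainsEquicard _).2 ?_, .of_maxChainsEquicard hdual.orderDual⟩
  exact .of_orderIso (PrimeSpectrum.pointsEquivIrreducibleCloseds _).symm.dual hdual
end
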